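/- arXiv:2307.15969 — 9 statements merged into one kernel-verified Lean document; each statement's English description precedes it below -/
import Mathlib

section
/- Let G = (V,E,w) be a finite undirected graph with positive edge weights and N = |V| ≥ 1 vertices, and suppose the LOWD iterative process is run from the equal-split initialization f_e(u) = f_e(v) = w_e/2. Then the sequence (D_t)_{t≥0} of maximum vertex loads after t iterations is nonincreasing and converges to ρ*, the maximum density over all nonempty vertex subsets of G. -/
open Finset

noncomputable section

variable {V : Type*} [Fintype V] [DecidableEq V]

/-- Total weight `W(S)` of edges with both endpoints in `S`
(for a symmetric weight function with zero diagonal). -/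
def wgt (w : V → V → ℝ) (S : Finset V) : ℝ := (∑ u ∈ S, ∑ v ∈ S, w u v) / 2

/-- Density `ρ(S) = W(S)/|S|` of the subgraph induced by `S`. -/
def density (w : V → V → ℝ) (S : Finset V) : ℝ := wgt w S / S.card

/-- Weighted degree of `u` within `S`. -/
def wdeg (w : V → V → ℝ) (S : Finset V) (u : V) : ℝ := ∑ v ∈ S, w u v

/-- `f` is an edge-weight distribution for the weight function `w`:
`f u v` is the share of the weight of edge `{u,v}` assigned to `u`. -/
def IsDistrib (w f : V → V → ℝ) : Prop :=
  (∀ u v, 0 ≤ f u v) ∧ (∀ u v, f u v + f v u = w u v)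

/-- Load `ℓ_v` of vertex `v` under the distribution `f`. -/
def load (f : V → V → ℝ) (v : V) : ℝ := ∑ u, f v u

/-- Transfer `d` units of the weight of edge `{u,v}` from `u`'s share to `v`'s share. -/
def lowdTransfer (f : V → V → ℝ) (u v : V) (d : ℝ) : V → V → ℝ :=
  fun x y =>
    if x = u ∧ y = v then f u v - d
    else if x = v ∧ y = u then f v u + d
    else f x y

/-- The LOWD update on the edge `p = (u,v)`: with `ℓ_u ≥ ℓ_v`, transfer
`d = min{(ℓ_u − ℓ_v)/2, f_e(u)}` from `u`'s share to `v`'s share. -/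
def lowdStep (f : V → V → ℝ) (p : V × V) : V → V → ℝ :=
  if load f p.2 ≤ load f p.1 then
    lowdTransfer f p.1 p.2 (min ((load f p.1 - load f p.2) / 2) (f p.1 p.2))
  else
    lowdTransfer f p.2 p.1 (min ((load f p.2 - load f p.1) / 2) (f p.2 p.1))

/-- One LOWD iteration: process every edge of the list `es` once,
in the fixed order given by `es`, applying the update sequentially. -/
def lowdIter (es : List (V × V)) (f : V → V → ℝ) : V → V → ℝ :=
  es.foldl lowdStep f

/-- The LOWD iterative process started from the equal-split
initialization `f_e(u) = f_e(v) = w_e / 2`. -/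
def lowdSeq (w : V → V → ℝ) (es : List (V × V)) (t : ℕ) : V → V → ℝ :=
  (lowdIter es)^[t] (fun u v => w u v / 2)

/-- The list `es` enumerates each (undirected, loopless, positive-weight) edge of `w`
exactly once. -/
def EnumeratesEdges (w : V → V → ℝ) (es : List (V × V)) : Prop :=
  es.Nodup ∧
  (∀ p ∈ es, p.1 ≠ p.2 ∧ 0 < w p.1 p.2) ∧
  (∀ p ∈ es, (p.2, p.1) ∉ es) ∧
  (∀ u v : V, u ≠ v → 0 < w u v → (u, v) ∈ es ∨ (v, u) ∈ es)

/-- `D_t`: the maximum vertex load after `t` LOWD iterations. -/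
def Dseq [Nonempty V] (w : V → V → ℝ) (es : List (V × V)) (t : ℕ) : ℝ :=
  Finset.univ.sup' Finset.univ_nonempty (load (lowdSeq w es t))

/-- Signed transfer amount, as a clamp. -/
def clampD (f : V → V → ℝ) (p : V × V) : ℝ :=
  max (-(f p.2 p.1)) (min ((load f p.1 - load f p.2) / 2) (f p.1 p.2))

/-- Continuous version of the LOWD step. -/
def stepC (f : V → V → ℝ) (p : V × V) : V → V → ℝ :=
  lowdTransfer f p.1 p.2 (clampD f p)

/-- Quadratic potential. -/
def pot (f : V → V → ℝ) : ℝ := ∑ v, load f v ^ 2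

theorem transfer_apply (f : V → V → ℝ) {u v : V} (h : u ≠ v) (d : ℝ) (x y : V) :
    lowdTransfer f u v d x y =
      f x y - (if x = u ∧ y = v then d else 0) + (if x = v ∧ y = u then d else 0) := by
  unfold lowdTransfer
  by_cases h1 : x = u ∧ y = v
  · obtain ⟨rfl, rfl⟩ := h1
    simp [h]
  · by_cases h2 : x = v ∧ y = u
    · obtain ⟨rfl, rfl⟩ := h2
      simp [h.symm]
    · simp [h1, h2]

theorem transfer_neg (f : V → V → ℝ) {u v : V} (h : u ≠ v) (d : ℝ) :
    lowdTransfer f v u d = lowdTransfer f u v (-d) := by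
  funext x y
  rw [transfer_apply f h, transfer_apply f h.symm]
  split_ifs <;> ring

theorem load_transfer (f : V → V → ℝ) {u v : V} (h : u ≠ v) (d : ℝ) (x : V) :
    load (lowdTransfer f u v d) x =
      load f x - (if x = u then d else 0) + (if x = v then d else 0) := by
  unfold load
  simp only [transfer_apply f h, Finset.sum_add_distrib, Finset.sum_sub_distrib, ite_and]
  congr 2
  · split_ifs <;> simp
  · split_ifs <;> simp

theorem step_eq {w f : V → V → ℝ} (hf : IsDistrib w f) {p : V × V} (h : p.1 ≠ p.2) :
    lowdStep f p = stepC f p := by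
  have h1 := hf.1 p.1 p.2
  have h2 := hf.1 p.2 p.1
  unfold lowdStep stepC clampD
  split_ifs with hl
  · congr 1
    rw [max_eq_right]
    apply le_min <;> linarith
  · push Not at hl
    rw [transfer_neg f h]
    congr 1
    rw [min_eq_left (a := (load f p.1 - load f p.2) / 2) (by linarith), ← max_neg_neg, max_comm]
    congr 1
    ring

theorem clamp_le {w f : V → V → ℝ} (hf : IsDistrib w f) (p : V × V) :
    clampD f p ≤ f p.1 p.2 := by
  have h1 := hf.1 p.1 p.2
  have h2 := hf.1 p.2 p.1
  exact max_le (by linarith) (min_le_right _ _)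

theorem clamp_ge (f : V → V → ℝ) (p : V × V) :
    -(f p.2 p.1) ≤ clampD f p := le_max_left _ _

theorem clamp_cases {w f : V → V → ℝ} (hf : IsDistrib w f) (p : V × V) :
    (0 ≤ clampD f p ∧ 2 * clampD f p ≤ load f p.1 - load f p.2) ∨
    (clampD f p ≤ 0 ∧ load f p.1 - load f p.2 ≤ 2 * clampD f p) := by
  have h1 := hf.1 p.1 p.2
  have h2 := hf.1 p.2 p.1
  unfold clampD
  rcases max_cases (-(f p.2 p.1)) (min ((load f p.1 - load f p.2) / 2) (f p.1 p.2)) with h | h <;>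
  rcases min_cases ((load f p.1 - load f p.2) / 2) (f p.1 p.2) with h' | h' <;>
  rcases le_total (load f p.1) (load f p.2) with h'' | h'' <;>
  first
  | (left; constructor <;> linarith)
  | (right; constructor <;> linarith)

theorem stepC_distrib {w f : V → V → ℝ} (hf : IsDistrib w f) {p : V × V} (h : p.1 ≠ p.2) :
    IsDistrib w (stepC f p) := by
  have h1 := clamp_le hf p
  have h2 := clamp_ge f p
  unfold stepC
  constructor
  · intro x y
    unfold lowdTransfer
    split_ifs
    · linarith
    · linarith
    · exact hf.1 x y
  · intro x y
    rw [← hf.2 x y, transfer_apply f h, transfer_apply f h]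
    split_ifs <;> first | ring1 | (exfalso; tauto)

theorem stepC_max {w f : V → V → ℝ} (hf : IsDistrib w f) {p : V × V} (h : p.1 ≠ p.2)
    {M : ℝ} (hM : ∀ v, load f v ≤ M) (v : V) : load (stepC f p) v ≤ M := by
  unfold stepC
  rw [load_transfer f h]
  have a := hM p.1
  have b := hM p.2
  have c := hM v
  by_cases h1 : v = p.1
  · have h2 : v ≠ p.2 := h1 ▸ h
    rw [if_pos h1, if_neg h2, h1]
    rcases clamp_cases hf p with h | h <;> linarith
  · by_cases h2 : v = p.2
    · rw [if_neg h1, if_pos h2, h2]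
      rcases clamp_cases hf p with h | h <;> linarith
    · rw [if_neg h1, if_neg h2]
      linarith

theorem stepC_pot {w f : V → V → ℝ} (hf : IsDistrib w f) {p : V × V} (h : p.1 ≠ p.2) :
    pot (stepC f p) + 2 * clampD f p ^ 2 ≤ pot f := by
  have key : pot (stepC f p) = pot f - 2 * clampD f p * (load f p.1 - load f p.2)
      + 2 * clampD f p ^ 2 := by
    unfold pot stepC
    have : ∀ v, load (lowdTransfer f p.1 p.2 (clampD f p)) v ^ 2 = load f v ^ 2 +
        (if v = p.1 then clampD f p ^ 2 - 2 * clampD f p * load f p.1 else 0) +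
        (if v = p.2 then clampD f p ^ 2 + 2 * clampD f p * load f p.2 else 0) := by
      intro v
      rw [load_transfer f h]
      by_cases h1 : v = p.1
      · have h2 : v ≠ p.2 := h1 ▸ h
        simp only [if_pos h1, if_neg h2]
        rw [← h1]
        ring
      · by_cases h2 : v = p.2
        · simp only [if_neg h1, if_pos h2]
          rw [← h2]
          ring
        · simp only [if_neg h1, if_neg h2]
          ring
    simp only [this, Finset.sum_add_distrib, Finset.sum_ite_eq', Finset.sum_ite_eq,
      Finset.mem_univ, if_true]
    ring
  rw [key]
  rcases clamp_cases hf p with h | h <;> nlinarith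

theorem fold_facts {w : V → V → ℝ} (es : List (V × V)) (hes : ∀ p ∈ es, p.1 ≠ p.2) :
    ∀ f, IsDistrib w f →
      lowdIter es f = es.foldl stepC f ∧ IsDistrib w (es.foldl stepC f) ∧
      (∀ M, (∀ v, load f v ≤ M) → ∀ v, load (es.foldl stepC f) v ≤ M) ∧
      pot (es.foldl stepC f) ≤ pot f ∧
      (pot (es.foldl stepC f) = pot f → ∀ p ∈ es, clampD f p = 0) := by
  induction es with
  | nil => intro f hf; simp [lowdIter, hf]
  | cons p es ih =>
    intro f hf
    have hp : p.1 ≠ p.2 := hes p (by simp)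
    obtain ⟨i1, i2, i3, i4, i5⟩ := ih (fun q hq => hes q (by simp [hq])) _ (stepC_distrib hf hp)
    have hpot := stepC_pot hf hp
    simp only [List.foldl_cons]
    refine ⟨?_, i2, ?_, ?_, ?_⟩
    · unfold lowdIter at *
      rw [List.foldl_cons, step_eq hf hp, i1]
    · intro M hM
      exact i3 M (stepC_max hf hp hM)
    · nlinarith [sq_nonneg (clampD f p)]
    · intro he
      have h0 : clampD f p = 0 := by
        have : clampD f p ^ 2 = 0 := le_antisymm (by linarith) (sq_nonneg _)
        simpa using this
      have hfix : stepC f p = f := by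
        unfold stepC
        rw [h0]
        funext x y
        rw [transfer_apply f hp]
        simp
      rw [hfix] at i5 he
      intro q hq
      rcases List.mem_cons.1 hq with rfl | hq
      · exact h0
      · exact i5 he q hq

theorem continuous_load (v : V) : Continuous (fun f : V → V → ℝ => load f v) := by
  unfold load
  fun_prop

theorem continuous_pot : Continuous (pot : (V → V → ℝ) → ℝ) := by
  unfold pot
  exact continuous_finset_sum _ fun v _ => (continuous_load v).pow 2

theorem continuous_stepC {p : V × V} (h : p.1 ≠ p.2) :
    Continuous (fun f : V → V → ℝ => stepC f p) := by
  have h1 := continuous_load (V := V) p.1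
  have h2 := continuous_load (V := V) p.2
  have hc : Continuous (fun f : V → V → ℝ => clampD f p) := by
    unfold clampD
    fun_prop
  refine continuous_pi fun x => continuous_pi fun y => ?_
  unfold stepC
  simp only [transfer_apply _ h]
  split_ifs <;> fun_prop

theorem continuous_fold (es : List (V × V)) (hes : ∀ p ∈ es, p.1 ≠ p.2) :
    Continuous (fun f : V → V → ℝ => es.foldl stepC f) := by
  induction es with
  | nil => exact continuous_id
  | cons p es ih =>
    simp only [List.foldl_cons]
    exact (ih (fun q hq => hes q (by simp [hq]))).comp (continuous_stepC (hes p (by simp)))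

theorem isCompact_distrib (w : V → V → ℝ) : IsCompact {f | IsDistrib w f} := by
  have hK : IsCompact (Set.pi Set.univ (fun u : V => Set.pi Set.univ
      (fun v : V => Set.Icc (0 : ℝ) (w u v)))) :=
    isCompact_univ_pi fun u => isCompact_univ_pi fun v => isCompact_Icc
  refine hK.of_isClosed_subset ?_ ?_
  · unfold IsDistrib
    simp only [Set.setOf_and, Set.setOf_forall]
    refine IsClosed.inter ?_ ?_
    · exact isClosed_iInter fun u => isClosed_iInter fun v =>
        isClosed_le continuous_const (by fun_prop)
    · exact isClosed_iInter fun u => isClosed_iInter fun v =>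
        isClosed_eq (by fun_prop) continuous_const
  · intro f hf u _ v _
    have := hf.1 v u
    have h2 := hf.2 u v
    exact ⟨hf.1 u v, by linarith⟩

/-- Maximum load of a distribution. -/
def maxLoad [Nonempty V] (f : V → V → ℝ) : ℝ :=
  Finset.univ.sup' Finset.univ_nonempty (load f)

theorem load_le_maxLoad [Nonempty V] (f : V → V → ℝ) (v : V) : load f v ≤ maxLoad f :=
  Finset.le_sup' (load f) (Finset.mem_univ v)

theorem continuous_maxLoad [Nonempty V] : Continuous (maxLoad : (V → V → ℝ) → ℝ) := by
  unfold maxLoad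
  exact Continuous.finset_sup'_apply _ fun v _ => continuous_load v

theorem wgt_eq {w f : V → V → ℝ} (hf : IsDistrib w f) (S : Finset V) :
    wgt w S = ∑ u ∈ S, ∑ v ∈ S, f u v := by
  unfold wgt
  have : ∑ u ∈ S, ∑ v ∈ S, w u v = ∑ u ∈ S, ∑ v ∈ S, f u v + ∑ u ∈ S, ∑ v ∈ S, f v u := by
    simp only [← Finset.sum_add_distrib, hf.2]
  rw [this, Finset.sum_comm (f := fun u v => f v u)]
  ring

theorem density_le [Nonempty V] {w f : V → V → ℝ} (hf : IsDistrib w f) {S : Finset V}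
    (hS : S.Nonempty) : density w S ≤ maxLoad f := by
  unfold density
  have hc : (0 : ℝ) < S.card := by exact_mod_cast hS.card_pos
  rw [div_le_iff₀ hc, wgt_eq hf]
  calc ∑ u ∈ S, ∑ v ∈ S, f u v ≤ ∑ u ∈ S, maxLoad f := by
        refine Finset.sum_le_sum fun u _ => le_trans ?_ (load_le_maxLoad f u)
        exact Finset.sum_le_sum_of_subset_of_nonneg (Finset.subset_univ S)
          fun v _ _ => hf.1 u v
    _ = maxLoad f * S.card := by rw [Finset.sum_const, nsmul_eq_mul, mul_comm]

theorem fixed_density [Nonempty V] {w f : V → V → ℝ} (hnonneg : ∀ u v, 0 ≤ w u v)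
    (hf : IsDistrib w f)
    (es : List (V × V)) (hes : EnumeratesEdges w es) (h0 : ∀ p ∈ es, clampD f p = 0) :
    ∃ S : Finset V, S.Nonempty ∧ density w S = maxLoad f := by
  let S : Finset V := Finset.univ.filter fun v => load f v = maxLoad f
  have hS : S.Nonempty := by
    obtain ⟨v, -, hv⟩ := Finset.exists_mem_eq_sup' Finset.univ_nonempty (load f)
    exact ⟨v, by simp [S, maxLoad, hv]⟩
  refine ⟨S, hS, ?_⟩
  have hz : ∀ u ∈ S, ∀ v, v ∉ S → f u v = 0 := by
    intro u hu v hv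
    have hlu : load f u = maxLoad f := by simpa [S] using hu
    have hlv : load f v < maxLoad f := lt_of_le_of_ne (load_le_maxLoad f v) (by simpa [S] using hv)
    have huv : u ≠ v := fun h => hv (h ▸ hu)
    have n1 := hf.1 u v
    have n2 := hf.1 v u
    have n3 := hf.2 u v
    rcases (hnonneg u v).eq_or_lt with h | h
    · linarith
    · rcases hes.2.2.2 u v huv h with h | h
      · have := h0 _ h
        simp only [clampD] at this
        have h3 : min ((load f u - load f v) / 2) (f u v) ≤ 0 := this ▸ le_max_right _ _
        rcases min_le_iff.1 h3 with h | h <;> linarith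
      · have := h0 _ h
        simp only [clampD] at this
        rcases max_choice (-(f u v)) (min ((load f v - load f u) / 2) (f v u)) with h | h
        · linarith
        · have := min_le_left ((load f v - load f u) / 2) (f v u)
          linarith
  have hc : (S.card : ℝ) ≠ 0 := by exact_mod_cast hS.card_pos.ne'
  unfold density
  rw [div_eq_iff hc, wgt_eq hf]
  calc ∑ u ∈ S, ∑ v ∈ S, f u v = ∑ u ∈ S, maxLoad f := by
        refine Finset.sum_congr rfl fun u hu => ?_
        have hlu : load f u = maxLoad f := by simpa [S] using hu
        rw [← hlu]
        exact Finset.sum_subset (Finset.subset_univ S) fun v _ hv => hz u hu v hv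
    _ = maxLoad f * S.card := by rw [Finset.sum_const, nsmul_eq_mul, mul_comm]

/-- For a finite undirected graph with positive edge weights and at
least one vertex, running LOWD from the equal-split initialization, the sequence
`(D_t)` of maximum vertex loads is nonincreasing and converges to `ρ*`, the maximum
density over all nonempty vertex subsets. -/
theorem lowd_Dseq_antitone_and_tendsto_maxDensity
    [Nonempty V] (w : V → V → ℝ)
    (hsymm : ∀ u v, w u v = w v u)
    (hnonneg : ∀ u v, 0 ≤ w u v)
    (hdiag : ∀ v, w v v = 0)
    (es : List (V × V)) (hes : EnumeratesEdges w es)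
    (ρstar : ℝ)
    (hρ : IsGreatest {d : ℝ | ∃ S : Finset V, S.Nonempty ∧ density w S = d} ρstar) :
    Antitone (Dseq w es) ∧
    Filter.Tendsto (Dseq w es) Filter.atTop (nhds ρstar) := by
  have hne : ∀ p ∈ es, p.1 ≠ p.2 := fun p hp => (hes.2.1 p hp).1
  have hF := fold_facts (w := w) es hne
  have hsucc : ∀ t, lowdSeq w es (t + 1) = lowdIter es (lowdSeq w es t) := fun t => by
    unfold lowdSeq
    rw [Function.iterate_succ_apply']
  have hK : ∀ t, IsDistrib w (lowdSeq w es t) := by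
    intro t
    induction t with
    | zero =>
      constructor
      · intro u v
        have := hnonneg u v
        simp only [lowdSeq, Function.iterate_zero, id]
        linarith
      · intro u v
        have := hsymm u v
        simp only [lowdSeq, Function.iterate_zero, id]
        linarith
    | succ t ih =>
      rw [hsucc, (hF _ ih).1]
      exact (hF _ ih).2.1
  have hsucc' : ∀ t, lowdSeq w es (t + 1) = es.foldl stepC (lowdSeq w es t) := fun t => by
    rw [hsucc, (hF _ (hK t)).1]
  have hDdef : ∀ t, Dseq w es t = maxLoad (lowdSeq w es t) := fun t => rfl
  have hanti : Antitone (Dseq w es) := by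
    refine antitone_nat_of_succ_le fun t => ?_
    rw [hDdef, hDdef, hsucc']
    exact Finset.sup'_le _ _ fun v _ =>
      (hF _ (hK t)).2.2.1 _ (load_le_maxLoad _) v
  refine ⟨hanti, ?_⟩
  have hlow : ∀ t, ρstar ≤ Dseq w es t := by
    intro t
    obtain ⟨S, hS, rfl⟩ := hρ.1
    exact density_le (hK t) hS
  have hpanti : Antitone (fun t => pot (lowdSeq w es t)) := by
    refine antitone_nat_of_succ_le fun t => ?_
    rw [hsucc']
    exact (hF _ (hK t)).2.2.2.1
  have hD := tendsto_atTop_ciInf hanti ⟨ρstar, by rintro _ ⟨t, rfl⟩; exact hlow t⟩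
  have hP := tendsto_atTop_ciInf hpanti ⟨0, by
    rintro _ ⟨t, rfl⟩
    exact Finset.sum_nonneg fun v _ => sq_nonneg _⟩
  obtain ⟨g, hg, φ, hφ, hlim⟩ := (isCompact_distrib w).tendsto_subseq hK
  have e1 : maxLoad g = ⨅ t, Dseq w es t :=
    tendsto_nhds_unique ((continuous_maxLoad.tendsto g).comp hlim) (hD.comp hφ.tendsto_atTop)
  have e2 : pot g = ⨅ t, pot (lowdSeq w es t) :=
    tendsto_nhds_unique ((continuous_pot.tendsto g).comp hlim) (hP.comp hφ.tendsto_atTop)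
  have e3 : pot (es.foldl stepC g) = ⨅ t, pot (lowdSeq w es t) := by
    have c := ((continuous_pot.comp (continuous_fold es hne)).tendsto g).comp hlim
    refine tendsto_nhds_unique c ?_
    have h := (hP.comp (Filter.tendsto_add_atTop_nat 1)).comp hφ.tendsto_atTop
    refine h.congr fun n => ?_
    simp only [Function.comp]
    rw [hsucc']
  have h0 := (hF g hg).2.2.2.2 (e3.trans e2.symm)
  obtain ⟨S, hS, hSd⟩ := fixed_density hnonneg hg es hes h0
  have hle : maxLoad g ≤ ρstar := hρ.2 ⟨S, hS, hSd⟩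
  have hge : ρstar ≤ maxLoad g := by
    obtain ⟨S, hS, rfl⟩ := hρ.1
    exact density_le hg hS
  rw [← e1, le_antisymm hle hge] at hD
  exact hD
end
end

section
/- Let G = (V,E,w) be a finite undirected graph with positive edge weights, f an edge-weight distribution on G with load vector ℓ, D = max_{v∈V} ℓ_v, and A = {u ∈ V : ℓ_u = D}. If for every edge e = (u,v) with u ∈ A and v ∉ A one has f_e(u) = 0, then ρ(A) = D; consequently, if additionally D > ρ*, a contradiction arises, so whenever D > ρ* there exist an edge e = (u,v) with ℓ_u = D, ℓ_v < D, and f_e(u) > 0. -/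
open Finset

noncomputable section

variable {V : Type*} [Fintype V] [DecidableEq V]

/-- Let `D = max_v ℓ_v` and `A = {u : ℓ_u = D}`. If every edge
`e = (u,v)` with `u ∈ A`, `v ∉ A` has `f_e(u) = 0`, then `ρ(A) = D`; consequently,
whenever `D > ρ*` there exist an edge `e = (u,v)` with `ℓ_u = D`, `ℓ_v < D` and
`f_e(u) > 0`. -/
theorem max_load_class_density
    [Nonempty V] (w f : V → V → ℝ)
    (hsymm : ∀ u v, w u v = w v u)
    (hnonneg : ∀ u v, 0 ≤ w u v)
    (hdiag : ∀ v, w v v = 0)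
    (hf : IsDistrib w f)
    (D : ℝ) (hD : D = Finset.univ.sup' Finset.univ_nonempty (load f))
    (A : Finset V) (hA : A = Finset.univ.filter (fun v => load f v = D))
    (ρstar : ℝ)
    (hρ : IsGreatest {d : ℝ | ∃ S : Finset V, S.Nonempty ∧ density w S = d} ρstar) :
    ((∀ u v : V, 0 < w u v → load f u = D → load f v ≠ D → f u v = 0) →
        density w A = D) ∧
    (ρstar < D →
        ∃ u v : V, 0 < w u v ∧ load f u = D ∧ load f v < D ∧ 0 < f u v) := by
  obtain ⟨hf0, hfw⟩ := hf
  have hle : ∀ v, load f v ≤ D := fun v => by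
    rw [hD]; exact Finset.le_sup' (load f) (Finset.mem_univ v)
  have hAne : A.Nonempty := by
    obtain ⟨v, _, hv⟩ := Finset.exists_mem_eq_sup' Finset.univ_nonempty (load f)
    exact ⟨v, by rw [hA, Finset.mem_filter]; exact ⟨Finset.mem_univ v, by rw [hD, hv]⟩⟩
  have hmem : ∀ v, v ∈ A ↔ load f v = D := fun v => by simp [hA]
  have key : (∀ u v : V, 0 < w u v → load f u = D → load f v ≠ D → f u v = 0) →
      density w A = D := by
    intro h
    have hload : ∀ u ∈ A, ∑ v ∈ A, f u v = D := by
      intro u hu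
      have hu' := (hmem u).1 hu
      rw [← hu']
      unfold load
      apply Finset.sum_subset (Finset.subset_univ A)
      intro v _ hv
      rcases (hnonneg u v).lt_or_eq with hw | hw
      · exact h u v hw hu' (fun h' => hv ((hmem v).2 h'))
      · linarith [hf0 u v, hf0 v u, hfw u v]
    have h1 : ∑ u ∈ A, ∑ v ∈ A, f u v = A.card * D := by
      rw [Finset.sum_congr rfl hload]; simp
    have h2 : ∑ u ∈ A, ∑ v ∈ A, f v u = A.card * D := by
      rw [Finset.sum_comm]; exact h1
    have h3 : ∑ u ∈ A, ∑ v ∈ A, w u v = 2 * (A.card * D) := by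
      simp only [← hfw, Finset.sum_add_distrib]
      rw [h1, h2]; ring
    have hc : (A.card : ℝ) ≠ 0 := by
      exact_mod_cast hAne.card_pos.ne'
    unfold density wgt
    rw [h3]
    field_simp
  refine ⟨key, fun hlt => ?_⟩
  by_contra hcon
  have hd : density w A = D := by
    apply key
    intro u v hw hu hv
    by_contra hne
    exact hcon ⟨u, v, hw, hu, lt_of_le_of_ne (hle v) hv, lt_of_le_of_ne (hf0 u v) (Ne.symm hne)⟩
  have : D ≤ ρstar := hρ.2 ⟨A, hAne, hd⟩
  linarith
end
end

section
/- Let G = (V,E,w) be a finite undirected graph with positive edge weights and f an edge-weight distribution on G satisfying the one-way condition. Let D = max_{v∈V} ℓ_v and A = {v ∈ V : ℓ_v = D}. Then ρ(A) = D, ρ(S) ≤ D for every nonempty S ⊆ V, and hence A is a densest subgraph of G and D = ρ*. -/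
open Finset

noncomputable section

variable {V : Type*} [Fintype V] [DecidableEq V]

/-- If the distribution `f` satisfies the one-way condition, then
with `D = max_v ℓ_v` and `A = {v : ℓ_v = D}` one has `ρ(A) = D`, `ρ(S) ≤ D` for
every nonempty `S`, and `A` is a densest subgraph with `D = ρ*`. -/
theorem one_way_gives_densest
    [Nonempty V] (w f : V → V → ℝ)
    (hsymm : ∀ u v, w u v = w v u)
    (hnonneg : ∀ u v, 0 ≤ w u v)
    (hdiag : ∀ v, w v v = 0)
    (hf : IsDistrib w f)
    (honeway : ∀ u v : V, 0 < w u v → load f v < load f u → f u v = 0)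
    (D : ℝ) (hD : D = Finset.univ.sup' Finset.univ_nonempty (load f))
    (A : Finset V) (hA : A = Finset.univ.filter (fun v => load f v = D))
    (ρstar : ℝ)
    (hρ : IsGreatest {d : ℝ | ∃ S : Finset V, S.Nonempty ∧ density w S = d} ρstar) :
    density w A = D ∧
    (∀ S : Finset V, S.Nonempty → density w S ≤ D) ∧
    D = ρstar ∧ A.Nonempty ∧ density w A = ρstar := by
  obtain ⟨hf0, hfw⟩ := hf
  have hW : ∀ S : Finset V, wgt w S = ∑ u ∈ S, ∑ v ∈ S, f u v := by
    intro S
    have h1 : ∑ u ∈ S, ∑ v ∈ S, w u v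
        = ∑ u ∈ S, ∑ v ∈ S, f u v + ∑ u ∈ S, ∑ v ∈ S, f v u := by
      simp only [← hfw, Finset.sum_add_distrib]
    have h2 : ∑ u ∈ S, ∑ v ∈ S, f v u = ∑ u ∈ S, ∑ v ∈ S, f u v := Finset.sum_comm
    unfold wgt
    rw [h1, h2]
    ring
  have hle : ∀ v, load f v ≤ D := by
    intro v
    rw [hD]
    exact Finset.le_sup' (load f) (Finset.mem_univ v)
  have hmem : ∀ v, v ∈ A ↔ load f v = D := by
    intro v
    simp [hA]
  have hAne : A.Nonempty := by
    obtain ⟨v, _, hv⟩ := Finset.exists_mem_eq_sup' Finset.univ_nonempty (load f)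
    exact ⟨v, (hmem v).2 (by rw [hD, hv])⟩
  have hS : ∀ S : Finset V, S.Nonempty → density w S ≤ D := by
    intro S hSne
    have hc : (0 : ℝ) < S.card := by exact_mod_cast hSne.card_pos
    unfold density
    rw [div_le_iff₀ hc, hW]
    calc ∑ u ∈ S, ∑ v ∈ S, f u v ≤ ∑ u ∈ S, D := by
          refine Finset.sum_le_sum fun u _ => le_trans ?_ (hle u)
          exact Finset.sum_le_sum_of_subset_of_nonneg (Finset.subset_univ S)
            (fun v _ _ => hf0 u v)
      _ = D * S.card := by
          rw [Finset.sum_const, nsmul_eq_mul, mul_comm]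
  have hAD : density w A = D := by
    have hc : (0 : ℝ) < A.card := by exact_mod_cast hAne.card_pos
    unfold density
    rw [div_eq_iff hc.ne', hW]
    calc ∑ u ∈ A, ∑ v ∈ A, f u v = ∑ u ∈ A, D := by
          refine Finset.sum_congr rfl fun u hu => ?_
          rw [← (hmem u).1 hu]
          refine Finset.sum_subset (Finset.subset_univ A) fun v _ hv => ?_
          rcases (hnonneg u v).lt_or_eq with h | h
          · refine honeway u v h ?_
            rw [(hmem u).1 hu]
            exact lt_of_le_of_ne (hle v) (fun h' => hv ((hmem v).2 h'))
          · have := hfw u v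
            linarith [hf0 u v, hf0 v u]
      _ = D * A.card := by
          rw [Finset.sum_const, nsmul_eq_mul, mul_comm]
  have hDρ : D = ρstar := by
    apply le_antisymm
    · exact hρ.2 ⟨A, hAne, hAD⟩
    · obtain ⟨S, hSne, hSd⟩ := hρ.1
      rw [← hSd]
      exact hS S hSne
  exact ⟨hAD, hS, hDρ, hAne, hAD.trans hDρ⟩
end
end

section
/- Let G = (V,E,w) be a finite undirected graph with positive edge weights, f an edge-weight distribution with load vector ℓ, and e = (v₁,v₂) an edge with ℓ_{v₁} > ℓ_{v₂} and f_e(v₁) > 0. Let d = min{(ℓ_{v₁} − ℓ_{v₂})/2, f_e(v₁)} and define the updated loads ℓ'_{v₁} = ℓ_{v₁} − d, ℓ'_{v₂} = ℓ_{v₂} + d, and ℓ'_v = ℓ_v for all other v. Then Σ_{v∈V} (ℓ'_v)² = Σ_{v∈V} ℓ_v² + 2d·(d + ℓ_{v₂} − ℓ_{v₁}) < Σ_{v∈V} ℓ_v². -/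
open Finset

noncomputable section

variable {V : Type*} [Fintype V] [DecidableEq V]

/-- For an edge `e = (v₁,v₂)` with `ℓ_{v₁} > ℓ_{v₂}` and
`f_e(v₁) > 0`, the LOWD update with `d = min{(ℓ_{v₁}−ℓ_{v₂})/2, f_e(v₁)}` satisfies
`Σ_v (ℓ'_v)² = Σ_v ℓ_v² + 2d(d + ℓ_{v₂} − ℓ_{v₁}) < Σ_v ℓ_v²`. -/
theorem lowd_update_decreases_sum_sq
    (w f : V → V → ℝ)
    (hsymm : ∀ u v, w u v = w v u)
    (hnonneg : ∀ u v, 0 ≤ w u v)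
    (hdiag : ∀ v, w v v = 0)
    (hf : IsDistrib w f)
    (v₁ v₂ : V) (hedge : 0 < w v₁ v₂)
    (hload : load f v₂ < load f v₁) (hfe : 0 < f v₁ v₂)
    (d : ℝ) (hd : d = min ((load f v₁ - load f v₂) / 2) (f v₁ v₂))
    (ℓ' : V → ℝ)
    (hℓ' : ℓ' = fun x =>
      if x = v₁ then load f v₁ - d
      else if x = v₂ then load f v₂ + d
      else load f x) :
    (∑ v, (ℓ' v) ^ 2 =
        ∑ v, (load f v) ^ 2 + 2 * d * (d + load f v₂ - load f v₁)) ∧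
    ∑ v, (ℓ' v) ^ 2 < ∑ v, (load f v) ^ 2 := by
  have hne : v₂ ≠ v₁ := by
    rintro rfl
    exact lt_irrefl _ hload
  have hpt : ∀ v, (ℓ' v) ^ 2 = (load f v) ^ 2
      + ((if v = v₁ then (load f v₁ - d) ^ 2 - (load f v₁) ^ 2 else 0)
        + (if v = v₂ then (load f v₂ + d) ^ 2 - (load f v₂) ^ 2 else 0)) := by
    intro v
    subst hℓ'
    by_cases h1 : v = v₁
    · subst h1
      simp [hne.symm]
    · by_cases h2 : v = v₂
      · subst h2
        simp [hne]
      · simp [h1, h2]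
  have key : ∑ v, (ℓ' v) ^ 2 =
      ∑ v, (load f v) ^ 2 + 2 * d * (d + load f v₂ - load f v₁) := by
    rw [Finset.sum_congr rfl (fun v _ => hpt v), Finset.sum_add_distrib,
      Finset.sum_add_distrib, Finset.sum_ite_eq', Finset.sum_ite_eq']
    simp only [Finset.mem_univ, if_true]
    ring
  refine ⟨key, ?_⟩
  have hd0 : 0 < d := by
    rw [hd]
    exact lt_min (by linarith) hfe
  have hd1 : d ≤ (load f v₁ - load f v₂) / 2 := hd ▸ min_le_left _ _
  have : 0 < d * (load f v₁ - load f v₂ - d) := mul_pos hd0 (by linarith)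
  rw [key]
  linarith
end
end

section
/- Let G = (V,E,w) be a finite undirected graph with positive edge weights, let S* be a densest subgraph of G, and let H ⊆ V be a vertex set with S* ⊆ H. Then every v ∈ S* satisfies deg_H(v) ≥ ρ(H). Equivalently, any vertex v ∈ H with deg_H(v) < ρ(H) does not belong to S*, so such vertices may be pruned without removing any vertex of the densest subgraph. -/
open Finset

noncomputable section

variable {V : Type*} [Fintype V] [DecidableEq V]

/-- pruning is safe. If `S*` is a densest subgraph and
`S* ⊆ H`, then every `v ∈ S*` has `deg_H(v) ≥ ρ(H)`; equivalently, any `v ∈ H`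
with `deg_H(v) < ρ(H)` is not in `S*`. -/
theorem pruning_safe
    (w : V → V → ℝ)
    (hsymm : ∀ u v, w u v = w v u)
    (hnonneg : ∀ u v, 0 ≤ w u v)
    (hdiag : ∀ v, w v v = 0)
    (Sstar : Finset V) (hne : Sstar.Nonempty)
    (hmax : ∀ T : Finset V, T.Nonempty → density w T ≤ density w Sstar)
    (H : Finset V) (hsub : Sstar ⊆ H) :
    (∀ v ∈ Sstar, density w H ≤ wdeg w H v) ∧
    (∀ v ∈ H, wdeg w H v < density w H → v ∉ Sstar) := by
  have key : ∀ v ∈ Sstar, density w H ≤ wdeg w H v := by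
    intro v hv
    have h1 : density w H ≤ density w Sstar := hmax H (hne.mono hsub)
    have h2 : wdeg w Sstar v ≤ wdeg w H v :=
      Finset.sum_le_sum_of_subset_of_nonneg hsub (fun i _ _ => hnonneg v i)
    have hT : ∀ T : Finset V, wgt w T ≤ density w Sstar * T.card := by
      intro T
      rcases T.eq_empty_or_nonempty with rfl | hT
      · simp [wgt]
      · have hpos : (0 : ℝ) < T.card := by exact_mod_cast hT.card_pos
        have := hmax T hT
        unfold density at this ⊢
        exact (div_le_iff₀ hpos).1 this
    have hS : wgt w Sstar = density w Sstar * Sstar.card := by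
      have hpos : (0 : ℝ) < Sstar.card := by exact_mod_cast hne.card_pos
      unfold density
      field_simp
    have hcard : ((Sstar.erase v).card : ℝ) + 1 = Sstar.card := by
      exact_mod_cast Finset.card_erase_add_one hv
    have hdec : wgt w Sstar = wgt w (Sstar.erase v) + wdeg w Sstar v := by
      have e : ∀ u, ∑ x ∈ Sstar, w u x = ∑ x ∈ Sstar.erase v, w u x + w u v :=
        fun u => (Finset.sum_erase_add _ _ hv).symm
      unfold wgt wdeg
      rw [← Finset.sum_erase_add _ _ hv]
      simp only [e, Finset.sum_add_distrib, hdiag]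
      rw [Finset.sum_congr rfl (fun u _ => hsymm u v)]
      ring
    have h3 := hT (Sstar.erase v)
    rw [← hcard] at hS
    linarith
  exact ⟨key, fun v _ hlt hv => absurd (key v hv) (not_le.2 hlt)⟩
end
end

section
/- Let G = (V,E,w) be a finite undirected graph with positive edge weights, H ⊆ V a nonempty vertex set, and H' a nonempty proper subset of H such that every vertex v ∈ H' satisfies deg_H(v) < ρ(H). Then ρ(H \ H') > ρ(H). In particular, the density of the remaining subgraph strictly increases at every iteration of the pruning algorithm. -/
open Finset

noncomputable section

variable {V : Type*} [Fintype V] [DecidableEq V]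

/-- If every vertex of a nonempty proper subset `H' ⊊ H` has
weighted degree in `H` below `ρ(H)`, then removing `H'` strictly increases the
density: `ρ(H \ H') > ρ(H)`. -/
theorem pruning_density_increases
    (w : V → V → ℝ)
    (hsymm : ∀ u v, w u v = w v u)
    (hnonneg : ∀ u v, 0 ≤ w u v)
    (hdiag : ∀ v, w v v = 0)
    (H H' : Finset V) (hH : H.Nonempty) (hH' : H'.Nonempty)
    (hsub : H' ⊆ H) (hproper : H' ≠ H)
    (hdeg : ∀ v ∈ H', wdeg w H v < density w H) :
    density w H < density w (H \ H') := by
  have hA : (H \ H').Nonempty := by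
    rw [Finset.sdiff_nonempty]
    exact fun h => hproper (Finset.Subset.antisymm hsub h)
  have hHc : (0 : ℝ) < H.card := by exact_mod_cast hH.card_pos
  have hAc : (0 : ℝ) < (H \ H').card := by exact_mod_cast hA.card_pos
  have hcard : ((H \ H').card : ℝ) + H'.card = H.card := by
    exact_mod_cast Finset.card_sdiff_add_card_eq_card hsub
  have h1 : ∑ v ∈ H', wdeg w H v < H'.card * density w H := by
    have := Finset.sum_lt_sum_of_nonempty hH' hdeg
    simpa using this
  have hW : density w H * H.card = wgt w H := by
    unfold density
    field_simp
  have e1 : ∑ u ∈ H, ∑ v ∈ H, w u v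
      = ∑ u ∈ H \ H', ∑ v ∈ H, w u v + ∑ u ∈ H', ∑ v ∈ H, w u v :=
    (Finset.sum_sdiff hsub).symm
  have e2 : ∑ u ∈ H \ H', ∑ v ∈ H, w u v
      = ∑ u ∈ H \ H', ∑ v ∈ H \ H', w u v + ∑ u ∈ H \ H', ∑ v ∈ H', w u v := by
    rw [← Finset.sum_add_distrib]
    exact Finset.sum_congr rfl fun u _ => (Finset.sum_sdiff hsub).symm
  have e3 : ∑ u ∈ H \ H', ∑ v ∈ H', w u v ≤ ∑ u ∈ H', ∑ v ∈ H, w u v := by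
    rw [Finset.sum_comm]
    refine Finset.sum_le_sum fun v _ => ?_
    rw [Finset.sum_congr rfl fun u _ => hsymm u v]
    exact Finset.sum_le_sum_of_subset_of_nonneg Finset.sdiff_subset fun u _ _ => hnonneg v u
  have h2 : wgt w H ≤ wgt w (H \ H') + ∑ v ∈ H', wdeg w H v := by
    unfold wgt wdeg
    linarith
  have h3 : density w H * (H \ H').card < wgt w (H \ H') := by
    rw [← hcard] at hW
    linarith
  rw [show density w (H \ H') = wgt w (H \ H') / (H \ H').card from rfl, lt_div_iff₀ hAc]
  exact h3
end
end

section
/- Let G = (V,E,w) be a finite undirected graph with positive edge weights and N = |V|, and let k ≥ 0. Let C(k) denote the k-core of G, i.e., the unique maximal vertex set inducing a subgraph in which every vertex has weighted degree at least k, and assume C(k) is nonempty. Let v₁, v₂, …, v_N be any greedy-peeling order of V, i.e., for every i, the vertex v_i has minimum weighted degree in the subgraph induced by {v_i, v_{i+1}, …, v_N}. Then there exists an index i such that {v_i, v_{i+1}, …, v_N} = C(k); that is, the k-core is achieved as the remaining graph at some step of the greedy peeling algorithm. -/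
open Finset

noncomputable section

variable {V : Type*} [Fintype V] [DecidableEq V]

/-- Let `C` be the (nonempty) `k`-core of the graph, i.e. the
unique maximal vertex set in which every vertex has weighted degree at least `k`,
and let `v₁, …, v_N` be a greedy-peeling order (each `vᵢ` has minimum weighted
degree in the subgraph induced by `{vᵢ, …, v_N}`). Then some suffix
`{vᵢ, …, v_N}` equals `C`: the `k`-core is achieved at some step of greedy peeling. -/
theorem kcore_achieved_by_greedy_peeling
    (w : V → V → ℝ)
    (hsymm : ∀ u v, w u v = w v u)
    (hnonneg : ∀ u v, 0 ≤ w u v)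
    (hdiag : ∀ v, w v v = 0)
    (k : ℝ) (hk : 0 ≤ k)
    (C : Finset V)
    (hCcore : ∀ u ∈ C, k ≤ wdeg w C u)
    (hCmax : ∀ S : Finset V, (∀ u ∈ S, k ≤ wdeg w S u) → S ⊆ C)
    (hCne : C.Nonempty)
    (L : List V) (hnodup : L.Nodup) (hall : ∀ v : V, v ∈ L)
    (hgreedy : ∀ (i : ℕ) (h : i < L.length), ∀ u ∈ (L.drop i).toFinset,
        wdeg w (L.drop i).toFinset (L.get ⟨i, h⟩) ≤ wdeg w (L.drop i).toFinset u) :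
    ∃ i : ℕ, (L.drop i).toFinset = C := by
  by_contra! hne
  have key : ∀ i : ℕ, C ⊆ (L.drop i).toFinset := by
    intro i
    induction i with
    | zero => intro v _; simpa using hall v
    | succ i ih =>
      by_cases h : i < L.length
      · have hnot : L.get ⟨i, h⟩ ∉ C := by
          intro hmem
          apply hne i
          refine Finset.Subset.antisymm (hCmax _ ?_) ih
          intro u hu
          refine le_trans (hCcore _ hmem) (le_trans ?_ (hgreedy i h u hu))
          exact Finset.sum_le_sum_of_subset_of_nonneg ih (fun v _ _ => hnonneg _ v)
        intro v hv
        have hv' := ih hv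
        rw [List.mem_toFinset, List.drop_eq_getElem_cons h, List.mem_cons] at hv'
        rcases hv' with rfl | hv'
        · exact absurd hv hnot
        · exact List.mem_toFinset.mpr hv'
      · rw [List.drop_eq_nil_of_le (by omega)] at ih ⊢
        exact ih
  obtain ⟨v, hv⟩ := hCne
  simpa using key L.length hv
end
end

section
/- Let G = (V,E,w) be a finite undirected graph with positive edge weights and f an edge-weight distribution on G satisfying the one-way condition, with load vector ℓ. Let λ ∈ ℝ and B = {v ∈ V : ℓ_v ≥ λ}, and suppose B is nonempty and ℓ_v < λ for every v ∉ B. Then ρ(B) = (Σ_{u∈B} ℓ_u)/|B|, and for every vertex set S with |S| ≥ |B| one has ρ(S) ≤ ρ(B). In particular, B is a densest subgraph among all subgraphs on at least |B| vertices (it solves the densest at-least-k subgraph problem for k = |B|). -/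
open Finset

noncomputable section

variable {V : Type*} [Fintype V] [DecidableEq V]

/-- If `f` satisfies the one-way condition and
`B = {v : ℓ_v ≥ λ}` is nonempty (so `ℓ_v < λ` for every `v ∉ B`), then
`ρ(B) = (Σ_{u∈B} ℓ_u)/|B|` and `ρ(S) ≤ ρ(B)` for every `S` with `|S| ≥ |B|`;
thus `B` solves the densest at-least-`k` subgraph problem for `k = |B|`. -/
theorem level_set_densest_at_least_k
    (w f : V → V → ℝ)
    (hsymm : ∀ u v, w u v = w v u)
    (hnonneg : ∀ u v, 0 ≤ w u v)
    (hdiag : ∀ v, w v v = 0)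
    (hf : IsDistrib w f)
    (honeway : ∀ u v : V, 0 < w u v → load f v < load f u → f u v = 0)
    (lam : ℝ) (B : Finset V)
    (hB : B = Finset.univ.filter (fun v => lam ≤ load f v))
    (hBne : B.Nonempty)
    (houtside : ∀ v : V, v ∉ B → load f v < lam) :
    density w B = (∑ u ∈ B, load f u) / B.card ∧
    ∀ S : Finset V, B.card ≤ S.card → density w S ≤ density w B := by
  obtain ⟨hf0, hfs⟩ := hf
  have hw : ∀ S : Finset V, wgt w S = ∑ u ∈ S, ∑ v ∈ S, f u v := by
    intro S
    have h1 : ∑ u ∈ S, ∑ v ∈ S, w u v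
        = ∑ u ∈ S, ∑ v ∈ S, f u v + ∑ u ∈ S, ∑ v ∈ S, f v u := by
      simp only [← Finset.sum_add_distrib, hfs]
    have h2 : ∑ u ∈ S, ∑ v ∈ S, f v u = ∑ u ∈ S, ∑ v ∈ S, f u v := Finset.sum_comm
    unfold wgt
    rw [h1, h2]
    ring
  have hin : ∀ v, v ∈ B → lam ≤ load f v := by
    intro v hv
    rw [hB] at hv
    simpa using hv
  have hle : ∀ S : Finset V, wgt w S ≤ ∑ u ∈ S, load f u := by
    intro S
    rw [hw]
    refine Finset.sum_le_sum fun u _ => ?_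
    exact Finset.sum_le_sum_of_subset_of_nonneg (Finset.subset_univ _) (fun v _ _ => hf0 u v)
  have hBeq : wgt w B = ∑ u ∈ B, load f u := by
    rw [hw]
    refine Finset.sum_congr rfl fun u hu => ?_
    refine Finset.sum_subset (Finset.subset_univ _) fun v _ hv => ?_
    rcases (hnonneg u v).lt_or_eq with h | h
    · exact honeway u v h ((houtside v hv).trans_le (hin u hu))
    · have := hfs u v
      have := hf0 u v
      have := hf0 v u
      linarith
  refine ⟨by rw [density, hBeq], fun S hS => ?_⟩
  have hBpos : (0 : ℝ) < B.card := by exact_mod_cast hBne.card_pos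
  have hSB : (B.card : ℝ) ≤ S.card := by exact_mod_cast hS
  have hSpos : (0 : ℝ) < S.card := hBpos.trans_le hSB
  have hD : ∑ u ∈ S, (load f u - lam) ≤ ∑ u ∈ B, (load f u - lam) := by
    rw [← Finset.sum_inter_add_sum_sdiff S B, ← Finset.sum_inter_add_sum_sdiff B S,
      Finset.inter_comm B S]
    have h1 : ∑ u ∈ S \ B, (load f u - lam) ≤ 0 :=
      Finset.sum_nonpos fun u hu => by
        have := houtside u (Finset.mem_sdiff.1 hu).2
        linarith
    have h2 : 0 ≤ ∑ u ∈ B \ S, (load f u - lam) :=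
      Finset.sum_nonneg fun u hu => by
        have := hin u (Finset.mem_sdiff.1 hu).1
        linarith
    linarith
  have hD0 : 0 ≤ ∑ u ∈ B, (load f u - lam) :=
    Finset.sum_nonneg fun u hu => sub_nonneg.2 (hin u hu)
  simp only [Finset.sum_sub_distrib, Finset.sum_const, nsmul_eq_mul] at hD hD0
  have hS' := hle S
  rw [density, density, hBeq, div_le_div_iff₀ hSpos hBpos]
  have h3 := mul_le_mul_of_nonneg_left hSB hD0
  have h4 := mul_le_mul_of_nonneg_right (hS'.trans (sub_le_iff_le_add.1 hD)) hBpos.le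
  nlinarith
end
end

section
/- Let G = (V,E,w) be a finite undirected graph with positive edge weights, and let f* be an edge-weight distribution that minimizes Σ_{v∈V} ℓ_v(f)² over all edge-weight distributions f on G. Then f* satisfies the one-way condition: for every edge e = (v₁,v₂), if ℓ_{v₁}(f*) > ℓ_{v₂}(f*) then f*_e(v₁) = 0. -/
open Finset

noncomputable section

variable {V : Type*} [Fintype V] [DecidableEq V]

/-- Any minimizer `f*` of `Σ_v ℓ_v(f)²` over all edge-weight
distributions satisfies the one-way condition: for every edge `e = (v₁,v₂)`,
if `ℓ_{v₁} > ℓ_{v₂}` then `f*_e(v₁) = 0`. -/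
theorem qp_minimizer_one_way
    (w fstar : V → V → ℝ)
    (hsymm : ∀ u v, w u v = w v u)
    (hnonneg : ∀ u v, 0 ≤ w u v)
    (hdiag : ∀ v, w v v = 0)
    (hf : IsDistrib w fstar)
    (hmin : ∀ g : V → V → ℝ, IsDistrib w g →
        ∑ v, (load fstar v) ^ 2 ≤ ∑ v, (load g v) ^ 2) :
    ∀ v₁ v₂ : V, 0 < w v₁ v₂ → load fstar v₂ < load fstar v₁ → fstar v₁ v₂ = 0 := by
  intro a b hw hlt
  by_contra hne
  have hpos : 0 < fstar a b := lt_of_le_of_ne (hf.1 a b) (Ne.symm hne)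
  have hab : a ≠ b := by
    rintro rfl
    exact lt_irrefl _ hlt
  obtain ⟨ε, hε, hε1, hε2⟩ : ∃ ε : ℝ, 0 < ε ∧ ε ≤ fstar a b ∧
      ε ≤ (load fstar a - load fstar b) / 2 :=
    ⟨min (fstar a b) ((load fstar a - load fstar b) / 2),
      lt_min hpos (by linarith), min_le_left _ _, min_le_right _ _⟩
  let g : V → V → ℝ := fun u v =>
    fstar u v + (if u = a then (if v = b then -ε else 0) else 0)
      + (if u = b then (if v = a then ε else 0) else 0)
  have hg : IsDistrib w g := by
    refine ⟨fun u v => ?_, fun u v => ?_⟩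
    · have h := hf.1 u v
      simp only [g]
      split_ifs <;> subst_vars <;> first | linarith | (exact absurd rfl hab)
    · have h := hf.2 u v
      simp only [g]
      split_ifs <;> subst_vars <;> first | linarith | (exact absurd rfl hab)
  have hload : ∀ v, load g v = load fstar v + (if v = a then -ε else 0)
      + (if v = b then ε else 0) := by
    intro v
    simp only [load, g, Finset.sum_add_distrib]
    congr 1
    · congr 1
      split_ifs <;> simp
    · split_ifs <;> simp
  have hsq : ∀ v, (load g v) ^ 2 = (load fstar v) ^ 2
      + (if v = a then ε ^ 2 - 2 * ε * load fstar a else 0)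
      + (if v = b then ε ^ 2 + 2 * ε * load fstar b else 0) := by
    intro v
    rw [hload]
    by_cases h1 : v = a
    · subst h1
      simp only [if_true, if_neg hab]
      ring
    · by_cases h2 : v = b
      · subst h2
        simp only [if_true, if_neg h1]
        ring
      · simp [h1, h2]
  have h := hmin g hg
  simp only [hsq, Finset.sum_add_distrib, Finset.sum_ite_eq', Finset.sum_ite_eq,
    Finset.mem_univ, if_true] at h
  nlinarith [mul_pos hε hε, mul_le_mul_of_nonneg_left hε2 hε.le]
end
end
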